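/- Let a, b, c, d ∈ ℂ satisfy a² + bc + ad + d² = 0, define τ(ν) = (aν + b)/(cν + d), g^{(0)} ≡ 1, g^{(1)}(ν) = (a + d)²·ν/((aν + b)(cν + d)), g^{(2)}(ν) = (a + d)²·ν/((dν − b)(−cν + a)), and the diagonal matrix k(ν) = diag((a + d)(aν + b), (cν − a)(dν − b)). Then k solves the 3-reflection equation for the trigonometric r-matrix: for all λ, ν at which all expressions are defined and all relevant matrices are invertible, ∑_{j=0}^{2} g^{(j)}(ν)·k^{(j)}_b(ν)·r(λ,τ^j(ν))·(k^{(j)}_b(ν))^{−1}·k_a(λ) = k_a(λ)·∑_{j=0}^{2} g^{(j)}(ν)·k^{(j)}_b(ν)·r(τ(λ),τ^j(ν))·(k^{(j)}_b(ν))^{−1}. -/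

import Mathlib

open Matrix Kronecker

noncomputable section

/-- `x_a = x ⊗ 1`, acting on `ℂ² ⊗ ℂ²`. -/
def legA (x : Matrix (Fin 2) (Fin 2) ℂ) : Matrix (Fin 2 × Fin 2) (Fin 2 × Fin 2) ℂ :=
  x ⊗ₖ (1 : Matrix (Fin 2) (Fin 2) ℂ)

/-- `x_b = 1 ⊗ x`, acting on `ℂ² ⊗ ℂ²`. -/
def legB (x : Matrix (Fin 2) (Fin 2) ℂ) : Matrix (Fin 2 × Fin 2) (Fin 2 × Fin 2) ℂ :=
  (1 : Matrix (Fin 2) (Fin 2) ℂ) ⊗ₖ x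

/-- `k⁽ʲ⁾(ν) = k⁽ʲ⁻¹⁾(ν) · k(τʲ⁻¹(ν))`, with `k⁽⁰⁾ = 1`. -/
def kiter (k : ℂ → Matrix (Fin 2) (Fin 2) ℂ) (τ : ℂ → ℂ) :
    ℕ → ℂ → Matrix (Fin 2) (Fin 2) ℂ
  | 0, _ => 1
  | j + 1, ν => kiter k τ j ν * k (τ^[j] ν)

/-- The trigonometric `r`-matrix on `ℂ² ⊗ ℂ²` (basis `e₁⊗e₁, e₁⊗e₂, e₂⊗e₁, e₂⊗e₂`). -/
def rtrig (lam ν : ℂ) : Matrix (Fin 2 × Fin 2) (Fin 2 × Fin 2) ℂ :=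
  (2 * (lam - ν))⁻¹ • Matrix.of fun i j =>
    if i = j then (if i.1 = i.2 then -lam - ν else lam + ν)
    else if i = ((0 : Fin 2), (1 : Fin 2)) ∧ j = ((1 : Fin 2), (0 : Fin 2)) then -4 * ν
    else if i = ((1 : Fin 2), (0 : Fin 2)) ∧ j = ((0 : Fin 2), (1 : Fin 2)) then -4 * lam
    else 0

/-- The Möbius map `τ(ν) = (aν + b)/(cν + d)`. -/
def tauM (a b c d ν : ℂ) : ℂ := (a * ν + b) / (c * ν + d)

/-- `g⁽⁰⁾ ≡ 1`, `g⁽¹⁾(ν) = (a+d)²ν/((aν+b)(cν+d))`, `g⁽²⁾(ν) = (a+d)²ν/((dν-b)(-cν+a))`. -/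
def gM (a b c d : ℂ) : ℕ → ℂ → ℂ
  | 0, _ => 1
  | 1, ν => (a + d) ^ 2 * ν / ((a * ν + b) * (c * ν + d))
  | 2, ν => (a + d) ^ 2 * ν / ((d * ν - b) * (-c * ν + a))
  | _ + 3, _ => 0

/-- `k(ν) = diag((a+d)(aν+b), (cν-a)(dν-b))`. -/
def kT (a b c d ν : ℂ) : Matrix (Fin 2) (Fin 2) ℂ :=
  Matrix.diagonal ![(a + d) * (a * ν + b), (c * ν - a) * (d * ν - b)]


lemma conj_entry (v : Fin 2 → ℂ) (hv : ∀ i, v i ≠ 0)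
    (M : Matrix (Fin 2 × Fin 2) (Fin 2 × Fin 2) ℂ) (i j : Fin 2 × Fin 2) :
    (legB (Matrix.diagonal v) * M * (legB (Matrix.diagonal v))⁻¹) i j
      = v i.2 * M i j * (v j.2)⁻¹ := by
  have e : ∀ w : Fin 2 → ℂ, legB (Matrix.diagonal w)
      = Matrix.diagonal (fun i : Fin 2 × Fin 2 => w i.2) := by
    intro w
    unfold legB
    rw [← Matrix.diagonal_one, Matrix.diagonal_kronecker_diagonal]
    simp
  have hinv : (legB (Matrix.diagonal v))⁻¹ = legB (Matrix.diagonal (fun i => (v i)⁻¹)) := by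
    apply Matrix.inv_eq_right_inv
    rw [e, e, Matrix.diagonal_mul_diagonal, ← Matrix.diagonal_one]
    congr 1
    funext i
    exact mul_inv_cancel₀ (hv _)
  rw [hinv, e, e, Matrix.mul_diagonal, Matrix.diagonal_mul]

lemma legA_diag (w : Fin 2 → ℂ) : legA (Matrix.diagonal w)
      = Matrix.diagonal (fun i : Fin 2 × Fin 2 => w i.1) := by
  unfold legA
  rw [← Matrix.diagonal_one, Matrix.diagonal_kronecker_diagonal]
  simp


lemma scalU (a b c d L n p q u w x y z s Q : ℂ) (h : a ^ 2 + b * c + a * d + d ^ 2 = 0)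
    (ep : p = a*n+b) (eq : q = c*n+d) (eu : u = d*n-b) (ew : w = -c*n+a) (es : s = a+d)
    (eQ : Q = c*L+d) (ex : x = L-n) (ey : y = L*q-p) (ez : z = L*w-u)
    (hp : p ≠ 0) (hq : q ≠ 0) (hs : s ≠ 0) (hx : x ≠ 0) (hy : y ≠ 0) (hz : z ≠ 0) :
    (n/x - s*n*w*u/(p*q*y) - s^3*n^2/(p*q*z)) * ((c*L-a)*(d*L-b))
      = s*(a*L+b)*(n*Q/z - Q*n*w*u/(p*q*(s*x)) + Q*s^2*n^2/(p*q*y)) := by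
  field_simp
  subst ep eq eu ew es eQ ex ey ez
  clear hp hq hs hx hy hz
  grind

lemma scalV (a b c d L n p q u w x y z s P : ℂ) (h : a ^ 2 + b * c + a * d + d ^ 2 = 0)
    (ep : p = a*n+b) (eq : q = c*n+d) (eu : u = d*n-b) (ew : w = -c*n+a) (es : s = a+d)
    (eP : P = a*L+b) (ex : x = L-n) (ey : y = L*q-p) (ez : z = L*w-u)
    (hw : w ≠ 0) (hu : u ≠ 0) (hs : s ≠ 0) (hx : x ≠ 0) (hy : y ≠ 0) (hz : z ≠ 0) :
    (L/x - s^3*n*L/(w*u*y) - s*p*q*L/(u*w*z)) * (s * (a*L+b))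
      = ((c*L-a)*(d*L-b)) * (P/z - s*n*P/(w*u*x) + p*q*P/(u*w*y)) := by
  field_simp
  subst ep eq eu ew es eP ex ey ez
  clear hw hu hs hx hy hz
  grind

lemma scalD (a b c d L n p q u w x y z s P Q : ℂ) (h : a ^ 2 + b * c + a * d + d ^ 2 = 0)
    (ep : p = a*n+b) (eq : q = c*n+d) (eu : u = d*n-b) (ew : w = -c*n+a) (es : s = a+d)
    (eP : P = a*L+b) (eQ : Q = c*L+d) (ex : x = L-n) (ey : y = L*q-p) (ez : z = L*w-u)
    (hp : p ≠ 0) (hq : q ≠ 0) (hw : w ≠ 0) (hu : u ≠ 0)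
    (hs : s ≠ 0) (hx : x ≠ 0) (hy : y ≠ 0) (hz : z ≠ 0) :
    (L+n)/x + s^2*n*(L*q+p)/(p*q*y) + s^2*n*(L*w+u)/(u*w*z)
      = (P+n*Q)/z + n*(P*q+p*Q)/(p*q*x) - s*n*(P*w+u*Q)/(u*w*y) := by
  field_simp
  subst ep eq eu ew es eP eQ ex ey ez
  clear hp hq hw hu hs hx hy hz
  grind

/-- The diagonal matrix `k(ν) = diag((a+d)(aν+b), (cν-a)(dν-b))` solves the 3-reflection equation for the
trigonometric `r`-matrix with `τ(ν) = (aν+b)/(cν+d)`, `a² + bc + ad + d² = 0`. -/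
theorem stmt15 (a b c d : ℂ) (hconstr : a ^ 2 + b * c + a * d + d ^ 2 = 0)
    (lam ν : ℂ)
    (h1 : lam ≠ ν) (h2 : lam ≠ tauM a b c d ν) (h3 : lam ≠ tauM a b c d (tauM a b c d ν))
    (h4 : tauM a b c d lam ≠ ν) (h5 : tauM a b c d lam ≠ tauM a b c d ν)
    (h6 : tauM a b c d lam ≠ tauM a b c d (tauM a b c d ν))
    (h7 : c * ν + d ≠ 0) (h8 : c * lam + d ≠ 0) (h9 : c * tauM a b c d ν + d ≠ 0)
    (h10 : a * ν + b ≠ 0) (h11 : d * ν - b ≠ 0) (h12 : -c * ν + a ≠ 0)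
    (h13 : IsUnit (kT a b c d ν)) (h14 : IsUnit (kT a b c d (tauM a b c d ν))) :
    (∑ j ∈ Finset.range 3, gM a b c d j ν •
        (legB (kiter (kT a b c d) (tauM a b c d) j ν) * rtrig lam ((tauM a b c d)^[j] ν)
          * (legB (kiter (kT a b c d) (tauM a b c d) j ν))⁻¹)) * legA (kT a b c d lam)
      = legA (kT a b c d lam) *
        ∑ j ∈ Finset.range 3, gM a b c d j ν •
          (legB (kiter (kT a b c d) (tauM a b c d) j ν)
            * rtrig (tauM a b c d lam) ((tauM a b c d)^[j] ν)
            * (legB (kiter (kT a b c d) (tauM a b c d) j ν))⁻¹) := by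
  have es : a + d ≠ 0 ∧ ν ≠ 0 := by
    rw [Matrix.isUnit_iff_isUnit_det] at h13 h14
    simp only [kT, Matrix.det_diagonal, Fin.prod_univ_two, isUnit_iff_ne_zero] at h13 h14
    refine ⟨fun h => h13 (by simp [h]), fun h => h14 ?_⟩
    subst h
    have hd : d ≠ 0 := by simpa using h7
    have : d * tauM a b c d 0 - b = 0 := by
      simp only [tauM]; simp; field_simp; ring
    simp [this]
  obtain ⟨hs, hn⟩ := es
  have lin : ∀ m n : ℂ, m * tauM a b c d ν + n
      = (m * (a * ν + b) + n * (c * ν + d)) / (c * ν + d) := by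
    intro m n
    rw [tauM, add_div (m * _), mul_div_cancel_right₀ _ h7, mul_div_assoc]
  have l1 : a * tauM a b c d ν + b = -(a + d) * (d * ν - b) / (c * ν + d) := by
    rw [lin]; congr 1; linear_combination ν * hconstr
  have l2 : c * tauM a b c d ν + d = -(a + d) * (-c * ν + a) / (c * ν + d) := by
    rw [lin]; congr 1; linear_combination hconstr
  have l3 : c * tauM a b c d ν - a = -(a + d) ^ 2 / (c * ν + d) := by
    rw [sub_eq_add_neg, lin]; congr 1; linear_combination hconstr
  have l4 : d * tauM a b c d ν - b = (a + d) ^ 2 * ν / (c * ν + d) := by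
    rw [sub_eq_add_neg, lin]; congr 1; linear_combination -ν * hconstr
  have hT2 : tauM a b c d (tauM a b c d ν) = (d * ν - b) / (-c * ν + a) := by
    rw [tauM, l1, l2, div_div_div_cancel_right₀ h7, mul_div_mul_left _ _ (neg_ne_zero.mpr hs)]
  rw [hT2] at h3 h6
  have hk1 : kT a b c d (tauM a b c d ν) = Matrix.diagonal
      ![-(a + d) ^ 2 * (d * ν - b) / (c * ν + d), -(a + d) ^ 4 * ν / (c * ν + d) ^ 2] := by
    rw [kT, l1, l3, l4]
    congr 1
    funext i
    fin_cases i
    · simp only [Fin.zero_eta, Matrix.cons_val_zero]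
      ring
    · simp only [Fin.mk_one, Matrix.cons_val_one, Matrix.cons_val_zero]
      rw [div_mul_div_comm]
      congr 1 <;> ring
  have hK1 : kiter (kT a b c d) (tauM a b c d) 1 ν = Matrix.diagonal
      ![(a + d) * (a * ν + b), -(-c * ν + a) * (d * ν - b)] := by
    simp only [kiter, Function.iterate_zero, id, one_mul, kT]
    congr 3
    ring
  have hK2 : kiter (kT a b c d) (tauM a b c d) 2 ν = Matrix.diagonal
      ![(a + d) * (a * ν + b) * (-(a + d) ^ 2 * (d * ν - b) / (c * ν + d)),
        -(-c * ν + a) * (d * ν - b) * (-(a + d) ^ 4 * ν / (c * ν + d) ^ 2)] := by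
    rw [kiter, hK1, Function.iterate_one, hk1, Matrix.diagonal_mul_diagonal]
    congr 1
    funext i
    fin_cases i <;> simp
  have hK0 : kiter (kT a b c d) (tauM a b c d) 0 ν = Matrix.diagonal ![1, 1] := by
    rw [kiter, ← Matrix.diagonal_one]
    congr 1
    funext i
    fin_cases i <;> simp
  have hv0 : ∀ i, (![1, 1] : Fin 2 → ℂ) i ≠ 0 := by
    intro i; fin_cases i <;> simp
  have hv1 : ∀ i, (![(a + d) * (a * ν + b), -(-c * ν + a) * (d * ν - b)] : Fin 2 → ℂ) i ≠ 0 := by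
    intro i
    fin_cases i
    · exact mul_ne_zero hs h10
    · exact mul_ne_zero (neg_ne_zero.mpr h12) h11
  have hv2 : ∀ i, (![(a + d) * (a * ν + b) * (-(a + d) ^ 2 * (d * ν - b) / (c * ν + d)),
        -(-c * ν + a) * (d * ν - b) * (-(a + d) ^ 4 * ν / (c * ν + d) ^ 2)] : Fin 2 → ℂ) i ≠ 0 := by
    intro i
    fin_cases i
    · exact mul_ne_zero (mul_ne_zero hs h10) (div_ne_zero
        (mul_ne_zero (neg_ne_zero.mpr (pow_ne_zero _ hs)) h11) h7)
    · exact mul_ne_zero (mul_ne_zero (neg_ne_zero.mpr h12) h11) (div_ne_zero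
        (mul_ne_zero (neg_ne_zero.mpr (pow_ne_zero _ hs)) hn) (pow_ne_zero _ h7))
  have hi2 : (tauM a b c d)^[2] ν = (d * ν - b) / (-c * ν + a) := hT2
  -- atoms
  obtain ⟨p, ep⟩ : ∃ p, p = a * ν + b := ⟨_, rfl⟩
  obtain ⟨q, eq⟩ : ∃ q, q = c * ν + d := ⟨_, rfl⟩
  obtain ⟨u, eu⟩ : ∃ u, u = d * ν - b := ⟨_, rfl⟩
  obtain ⟨w, ew⟩ : ∃ w, w = -c * ν + a := ⟨_, rfl⟩
  obtain ⟨s, e_s⟩ : ∃ s, s = a + d := ⟨_, rfl⟩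
  obtain ⟨P, eP⟩ : ∃ P, P = a * lam + b := ⟨_, rfl⟩
  obtain ⟨Q, eQ⟩ : ∃ Q, Q = c * lam + d := ⟨_, rfl⟩
  obtain ⟨x, ex⟩ : ∃ x, x = lam - ν := ⟨_, rfl⟩
  obtain ⟨y, ey⟩ : ∃ y, y = lam * q - p := ⟨_, rfl⟩
  obtain ⟨z, ez⟩ : ∃ z, z = lam * w - u := ⟨_, rfl⟩
  have hit1 : (tauM a b c d)^[1] ν = p / q := by rw [Function.iterate_one, tauM, ep, eq]
  have htl : tauM a b c d lam = P / Q := by rw [tauM, eP, eQ]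
  have ht1 : tauM a b c d ν = p / q := by rw [tauM, ep, eq]
  rw [← eu, ← ew] at hi2
  rw [← eu, ← ew] at h3
  rw [← eq] at h7
  rw [← eQ] at h8
  rw [← ep] at h10
  rw [← eu] at h11
  rw [← ew] at h12
  rw [← ep, ← eu, ← ew, ← e_s] at hK1 hv1
  rw [← ep, ← eu, ← ew, ← eq, ← e_s] at hK2 hv2
  rw [← e_s] at hs
  rw [ht1] at h2
  have hx : x ≠ 0 := by rw [ex]; exact sub_ne_zero.mpr h1
  have hy : y ≠ 0 := by
    rw [ey]
    intro h
    exact h2 (by rw [eq_div_iff h7]; linear_combination h)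
  have hz : z ≠ 0 := by
    rw [ez]
    intro h
    exact h3 (by rw [eq_div_iff h12]; linear_combination h)
  have d1 : lam - p / q = y / q := by rw [ey]; field_simp
  have d2 : lam - u / w = z / w := by rw [ez]; field_simp
  have d3 : P / Q - ν = z / Q := by
    have : z = P - ν * Q := by rw [ez, eP, eQ, eu, ew]; ring
    rw [this]; field_simp
  have d4 : P / Q - p / q = s ^ 2 * x / (Q * q) := by
    have : s ^ 2 * x = P * q - p * Q := by
      rw [ex, eP, eQ, ep, eq, e_s]; linear_combination (lam - ν) * hconstr
    rw [this]; field_simp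
  have d5 : P / Q - u / w = - s * y / (Q * w) := by
    have : - s * y = P * w - u * Q := by
      rw [ey, eP, eQ, ep, eq, e_s, eu, ew]; linear_combination (-lam + ν) * hconstr
    rw [this]; field_simp
  have g1 : gM a b c d 1 ν = s ^ 2 * ν / (p * q) := by rw [gM, e_s, ep, eq]
  have g2 : gM a b c d 2 ν = s ^ 2 * ν / (u * w) := by rw [gM, e_s, eu, ew]
  have g0 : gM a b c d 0 ν = 1 := rfl
  have hU := scalU a b c d lam ν p q u w x y z s Q hconstr ep eq eu ew e_s eQ ex ey ez
    h10 h7 hs hx hy hz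
  have hV := scalV a b c d lam ν p q u w x y z s P hconstr ep eq eu ew e_s eP ex ey ez
    h12 h11 hs hx hy hz
  have hD := scalD a b c d lam ν p q u w x y z s P Q hconstr ep eq eu ew e_s eP eQ ex ey ez
    h10 h7 h12 h11 hs hx hy hz
  simp only [Finset.sum_range_succ, Finset.sum_range_zero, zero_add, hK0, hK1, hK2, hit1, hi2, htl,
    g0, g1, g2, Function.iterate_zero, id]
  rw [kT, legA_diag]
  ext i j
  rw [Matrix.mul_diagonal, Matrix.diagonal_mul]
  simp only [Matrix.add_apply, Matrix.smul_apply, conj_entry _ hv0, conj_entry _ hv1,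
    conj_entry _ hv2, smul_eq_mul]
  simp only [rtrig, Matrix.smul_apply, Matrix.of_apply, smul_eq_mul, d1, d2, d3, d4, d5, ← ex, ← e_s]
  clear hK0 hK1 hK2 hit1 hi2 htl g0 g1 g2 hv0 hv1 hv2 hk1 hT2 h13 h14 h9 h2 h3 h4 h5 h6 ht1 d1 d2 d3 d4 d5
  obtain ⟨i1, i2⟩ := i
  obtain ⟨j1, j2⟩ := j
  fin_cases i1 <;> fin_cases i2 <;> fin_cases j1 <;> fin_cases j2 <;> simp
  · linear_combination (norm := skip) (-1/2) * (s * (a * lam + b)) * hD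
    clear * - h7 h8 h10 h11 h12 hs hx hy hz hn
    field_simp
    ring
  · linear_combination (norm := skip) (1/2) * (s * (a * lam + b)) * hD
    clear * - h7 h8 h10 h11 h12 hs hx hy hz hn
    field_simp
    ring
  · linear_combination (norm := skip) (-2) * hU
    clear * - h7 h8 h10 h11 h12 hs hx hy hz hn
    field_simp
    ring
  · linear_combination (norm := skip) (-2) * hV
    clear * - h7 h8 h10 h11 h12 hs hx hy hz hn
    field_simp
    ring
  · linear_combination (norm := skip) (1/2) * ((c * lam - a) * (d * lam - b)) * hD
    clear * - h7 h8 h10 h11 h12 hs hx hy hz hn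
    field_simp
    ring
  · linear_combination (norm := skip) (-1/2) * ((c * lam - a) * (d * lam - b)) * hD
    clear * - h7 h8 h10 h11 h12 hs hx hy hz hn
    field_simp
    ring
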